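/- arXiv:1509.00757 — 8 statements merged into one kernel-verified Lean document; each statement's English description precedes it below -/
import Mathlib

section
/- Web attachment preserves distances: Let r ≥ 3 be an integer, let G be a simple graph, let v_0 v_1 ⋯ v_{r−1} v_0 be a closed walk of length r in G (so v_i and v_{i+1 mod r} are adjacent in G for every i ∈ ℤ/rℤ; the v_i need not be pairwise distinct), and let G' be the graph obtained from G by attaching a web W_r along this walk. Then for all vertices u, w ∈ V(G), the extended distance satisfies edist_{G'}(u, w) = edist_G(u, w); moreover, every path in G' between two vertices of V(G) whose length equals their distance in G' contains no inner vertex of the attached web. -/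
/-!
Web attachment preserves distances (Lemma 11(i)).

The web gadget `W r` has vertices `x^i_j` for `i ∈ ℤ/rℤ`, `0 ≤ j ≤ r-1`,
plus an apex `u` (with the convention `x^i_r = u`), where `x^i_0 = v i` are
the base vertices.  Here the inner vertices (all vertices except the base)
are encoded as `Option (ZMod r × Fin (r-1))`: `some (i, t)` stands for
`x^i_{t+1}` and `none` stands for the apex `u`.
-/

/-- Inner vertices of the web gadget `W r`. -/
abbrev WebInner (r : ℕ) := Option (ZMod r × Fin (r - 1))

/-- The graph obtained from `G` by attaching a web `W r` along the closed walk
`v 0, v 1, …, v (r-1), v 0`.  Its edges are: the edges of `G`; the attachment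
edges `{v i, x^i_1}` and `{v i, x^{i+1}_1}` (i.e. `x^{j}_1` is joined to `v j`
and to `v (j-1)`); the path edges `{x^i_j, x^i_{j+1}}` (with `x^i_r = u`);
the cycle edges `{x^i_j, x^{i+1}_j}` for `1 ≤ j ≤ r-1`; and the diagonal
edges `{x^{i-1}_{j-1}, x^i_j}` for `2 ≤ j ≤ r-1` (the case `j = 1` being an
attachment edge). -/
def webAttach {V : Type*} (G : SimpleGraph V) (r : ℕ) (v : ZMod r → V) :
    SimpleGraph (V ⊕ WebInner r) :=
  SimpleGraph.fromRel fun a b =>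
    match a, b with
    | Sum.inl a, Sum.inl b => G.Adj a b
    | Sum.inl a, Sum.inr (some (i, t)) => t.val = 0 ∧ (a = v i ∨ a = v (i - 1))
    | Sum.inr (some (i, t)), Sum.inr (some (i', t')) =>
        (i' = i ∧ t'.val = t.val + 1) ∨ (i' = i + 1 ∧ t' = t) ∨
          (i' = i + 1 ∧ t'.val = t.val + 1)
    | Sum.inr (some (_, t)), Sum.inr none => t.val = r - 2
    | _, _ => False

/-- The set of vertices of `G` lying below a vertex of `webAttach G r v`: a vertex of `G` lies only
below itself, `x^i_j` has `v (i - m)` for `m ≤ j` below it, and the apex has all base vertices. -/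
def webShadow {V : Type*} {r : ℕ} (v : ZMod r → V) : V ⊕ WebInner r → Set V
  | Sum.inl a => {a}
  | Sum.inr (some (i, t)) => {w | ∃ m : ℕ, m ≤ t.val + 1 ∧ w = v (i - m)}
  | Sum.inr none => Set.range v

section

variable {V : Type*} {G : SimpleGraph V} {r : ℕ} {v : ZMod r → V}

theorem mem_webShadow_of_webAttach_adj {a : V} {z : WebInner r}
    (h : (webAttach G r v).Adj (Sum.inl a) (Sum.inr z)) : a ∈ webShadow v (Sum.inr z) := by
  rcases z with _ | ⟨i, t⟩
  · simp [webAttach] at h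
  · simp only [webAttach, SimpleGraph.fromRel_adj, or_false] at h
    obtain ⟨-, -, rfl | rfl⟩ := h
    · exact ⟨0, by omega, by simp⟩
    · exact ⟨1, by omega, by simp⟩

/-- The shadow of `x^i_j` is within distance one of the shadow of `x^{i'}_{j'}` whenever
`i' - i = s` and the index intervals `[i - j, i]` and `[i' - j', i']` differ by at most one
at both ends. -/
theorem exists_mem_webShadow_inner (hwalk : ∀ i : ZMod r, G.Adj (v i) (v (i + 1)))
    {i i' : ZMod r} {t t' : Fin (r - 1)} (s : ℤ) (hi : i' = i + s) (hs : |s| ≤ 1)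
    (ht : |s - (t'.val - t.val : ℤ)| ≤ 1) {a : V}
    (ha : a ∈ webShadow v (Sum.inr (some (i, t)))) :
    ∃ c ∈ webShadow v (Sum.inr (some (i', t'))), a = c ∨ G.Adj a c := by
  obtain ⟨m, hm, rfl⟩ := ha
  rw [abs_le] at hs ht
  have key : ∃ m' : ℕ, m' ≤ t'.val + 1 ∧
      ((m' : ℤ) = m + s ∨ (m' : ℤ) = m + s + 1 ∨ (m' : ℤ) = m + s - 1) := by
    by_cases h0 : (m : ℤ) + s < 0
    · exact ⟨0, by omega, by omega⟩
    by_cases h1 : (m : ℤ) + s ≤ t'.val + 1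
    · exact ⟨(m + s).toNat, by omega, by omega⟩
    · exact ⟨t'.val + 1, le_rfl, by omega⟩
  obtain ⟨m', hm', h⟩ := key
  refine ⟨_, ⟨m', hm', rfl⟩, ?_⟩
  rcases h with h | h | h <;> replace h := congrArg (Int.cast : ℤ → ZMod r) h <;>
    push_cast at h <;> rw [hi, h]
  · left; congr 1; ring
  · right
    have := (hwalk (i - m - 1)).symm
    rwa [sub_add_cancel, show i - m - 1 = i + s - (m + s + 1) by ring] at this
  · right
    have := hwalk (i - m)
    rwa [show i - m + 1 = i + s - (m + s - 1) by ring] at this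

theorem exists_mem_webShadow_of_webAttach_adj (hr : 3 ≤ r)
    (hwalk : ∀ i : ZMod r, G.Adj (v i) (v (i + 1))) {x y : V ⊕ WebInner r}
    (h : (webAttach G r v).Adj x y) {a : V} (ha : a ∈ webShadow v x) :
    ∃ c ∈ webShadow v y, a = c ∨ G.Adj a c := by
  have : NeZero r := ⟨by omega⟩
  rcases x with x | _ | ⟨i, t⟩ <;> rcases y with y | _ | ⟨i', t'⟩
  · obtain rfl : a = x := ha
    refine ⟨y, rfl, Or.inr ?_⟩
    simp only [webAttach, SimpleGraph.fromRel_adj] at h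
    exact h.2.elim id SimpleGraph.Adj.symm
  · obtain rfl : a = x := ha
    exact ⟨a, mem_webShadow_of_webAttach_adj h, Or.inl rfl⟩
  · obtain rfl : a = x := ha
    exact ⟨a, mem_webShadow_of_webAttach_adj h, Or.inl rfl⟩
  · simp [webAttach] at h
  · exact ⟨a, ha, Or.inl rfl⟩
  · simp only [webAttach, SimpleGraph.fromRel_adj, false_or] at h
    obtain ⟨k, rfl⟩ := ha
    refine ⟨_, ⟨(i' - k).val, ?_, rfl⟩, Or.inl ?_⟩
    · have := ZMod.val_lt (i' - k)
      omega
    · simp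
  · simp only [webAttach, SimpleGraph.fromRel_adj, false_or] at h
    obtain ⟨-, ht, hy⟩ := h
    obtain ⟨m, hm, rfl⟩ := ha
    refine ⟨y, rfl, ?_⟩
    have hw := hwalk (i - 1)
    rw [sub_add_cancel] at hw
    obtain rfl | rfl : m = 0 ∨ m = 1 := by omega
    · rcases hy with rfl | rfl
      · simp
      · simpa using Or.inr hw.symm
    · rcases hy with rfl | rfl
      · simpa using Or.inr hw
      · simp
  · obtain ⟨m, -, rfl⟩ := ha
    exact ⟨_, ⟨_, rfl⟩, Or.inl rfl⟩
  · simp only [webAttach, SimpleGraph.fromRel_adj] at h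
    rcases h.2 with (⟨hi, ht⟩ | ⟨hi, ht⟩ | ⟨hi, ht⟩) | (⟨hi, ht⟩ | ⟨hi, ht⟩ | ⟨hi, ht⟩)
    · exact exists_mem_webShadow_inner hwalk 0 (by simp [hi]) (by simp) (by simp [ht]) ha
    · exact exists_mem_webShadow_inner hwalk 1 (by simp [hi]) (by simp) (by simp [ht]) ha
    · exact exists_mem_webShadow_inner hwalk 1 (by simp [hi]) (by simp) (by simp [ht]) ha
    · exact exists_mem_webShadow_inner hwalk 0 (by simp [hi]) (by simp) (by simp [ht]) ha
    · exact exists_mem_webShadow_inner hwalk (-1) (by simp [hi]) (by simp) (by simp [ht]) ha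
    · exact exists_mem_webShadow_inner hwalk (-1) (by simp [hi]) (by simp) (by simp [ht]) ha

theorem edist_le_one_add_of_eq_or_adj {a b c : V} {n : ℕ∞} (h : a = c ∨ G.Adj a c)
    (hc : G.edist c b ≤ n) : G.edist a b ≤ n + 1 := by
  rcases h with rfl | h
  · exact hc.trans le_self_add
  · calc G.edist a b ≤ G.edist a c + G.edist c b := SimpleGraph.edist_triangle
      _ ≤ 1 + n := add_le_add (SimpleGraph.edist_eq_one_iff_adj.2 h).le hc
      _ = n + 1 := add_comm _ _

theorem edist_le_length_of_mem_webShadow (hr : 3 ≤ r)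
    (hwalk : ∀ i : ZMod r, G.Adj (v i) (v (i + 1))) {x y : V ⊕ WebInner r}
    (p : (webAttach G r v).Walk x y) {b : V} (hy : y = Sum.inl b) {a : V}
    (ha : a ∈ webShadow v x) : G.edist a b ≤ p.length := by
  induction p generalizing a with
  | nil =>
    subst hy
    obtain rfl : a = b := ha
    simp
  | cons h p ih =>
    obtain ⟨c, hc, hac⟩ := exists_mem_webShadow_of_webAttach_adj hr hwalk h ha
    simpa using edist_le_one_add_of_eq_or_adj hac (ih hy hc)

theorem edist_add_one_le_length_of_inr_mem_support (hr : 3 ≤ r)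
    (hwalk : ∀ i : ZMod r, G.Adj (v i) (v (i + 1))) {x y : V ⊕ WebInner r}
    (p : (webAttach G r v).Walk x y) {a b : V} (hx : x = Sum.inl a) (hy : y = Sum.inl b)
    {z : WebInner r} (hz : Sum.inr z ∈ p.support) : G.edist a b + 1 ≤ p.length := by
  induction p generalizing a with
  | nil => subst hy; simp at hz
  | @cons x w y h p ih =>
    subst hx
    rcases w with c | w
    · obtain ⟨d, rfl, hac⟩ := exists_mem_webShadow_of_webAttach_adj hr hwalk h rfl
      have hd := ih rfl hy (by simpa using hz)
      rw [SimpleGraph.Walk.length_cons, Nat.cast_add_one]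
      refine le_trans (add_le_add_left ?_ 1) (add_le_add_left hd 1)
      exact edist_le_one_add_of_eq_or_adj hac le_rfl
    · rw [SimpleGraph.Walk.length_cons, Nat.cast_add_one]
      exact add_le_add_left (edist_le_length_of_mem_webShadow hr hwalk p hy
        (mem_webShadow_of_webAttach_adj h)) 1

/-- The inclusion of `G` into the graph obtained from it by attaching a web. -/
def webAttachInl (G : SimpleGraph V) (v : ZMod r → V) : G →g webAttach G r v where
  toFun := Sum.inl
  map_rel' h := by simp [webAttach, h, h.ne]

theorem webAttach_edist_inl_le (G : SimpleGraph V) (v : ZMod r → V) (a b : V) :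
    (webAttach G r v).edist (Sum.inl a) (Sum.inl b) ≤ G.edist a b :=
  le_iInf fun p =>
    (SimpleGraph.edist_le (p.map (webAttachInl G v))).trans_eq (by rw [SimpleGraph.Walk.length_map])

end

/-- **Web attachment preserves distances.**  If `G'` is obtained from `G` by
attaching a web `W r` (`r ≥ 3`) along a closed walk `v 0, v 1, …, v (r-1), v 0`
of `G`, then the extended distance between any two vertices of `G` is the same
in `G'` as in `G`; moreover any shortest path of `G'` between two vertices of
`G` avoids all inner vertices of the attached web. -/
theorem webAttach_preserves_edist {V : Type*} (G : SimpleGraph V) (r : ℕ) (hr : 3 ≤ r)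
    (v : ZMod r → V) (hwalk : ∀ i : ZMod r, G.Adj (v i) (v (i + 1))) :
    (∀ a b : V,
      (webAttach G r v).edist (Sum.inl a) (Sum.inl b) = G.edist a b) ∧
    (∀ a b : V, ∀ p : (webAttach G r v).Walk (Sum.inl a) (Sum.inl b), p.IsPath →
      (p.length : ℕ∞) = (webAttach G r v).edist (Sum.inl a) (Sum.inl b) →
      ∀ x ∈ p.support, ∃ c : V, x = Sum.inl c) := by
  refine ⟨fun a b => (webAttach_edist_inl_le G v a b).antisymm (le_iInf fun p =>
    edist_le_length_of_mem_webShadow hr hwalk p rfl rfl), ?_⟩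
  intro a b p _ hp x hx
  rcases x with c | z
  · exact ⟨c, rfl⟩
  · have hlong := edist_add_one_le_length_of_inr_mem_support hr hwalk p rfl rfl hx
    have hshort : (p.length : ℕ∞) ≤ G.edist a b := hp.le.trans (webAttach_edist_inl_le G v a b)
    have h : (p.length : ℕ∞) + 1 ≤ p.length := (add_le_add_left hshort 1).trans hlong
    norm_cast at h
    omega
end

section
/- Web coverage: Let r ≥ 3 be an integer, let G be a simple graph, let v_0 v_1 ⋯ v_{r−1} v_0 be a closed walk of length r in G, and let G' be the graph obtained from G by attaching a web W_r along this walk. Then every inner vertex of the attached web is at distance at most r in G' from some vertex of G; concretely, for every inner vertex x of the web there exists i ∈ ℤ/rℤ with dist_{G'}(v_i, x) ≤ r. -/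
/-- Each vertex `x^i_{n+1}` of the web is joined to the base vertex `v i` by the initial segment of
a path of the web, which has length `n + 1`. -/
theorem webAttach_exists_walk_length {V : Type*} (G : SimpleGraph V) (r : ℕ) (v : ZMod r → V)
    (i : ZMod r) (n : ℕ) (hn : n < r - 1) :
    ∃ p : (webAttach G r v).Walk (Sum.inl (v i)) (Sum.inr (some (i, ⟨n, hn⟩))),
      p.length = n + 1 := by
  induction n with
  | zero =>
    have h : (webAttach G r v).Adj (Sum.inl (v i)) (Sum.inr (some (i, ⟨0, hn⟩))) := by
      simp [webAttach]
    exact ⟨h.toWalk, rfl⟩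
  | succ n ih =>
    obtain ⟨p, hp⟩ := ih (by omega)
    have h : (webAttach G r v).Adj (Sum.inr (some (i, ⟨n, by omega⟩)))
        (Sum.inr (some (i, ⟨n + 1, hn⟩))) := by
      simp [webAttach]
    exact ⟨p.concat h, by simp [hp]⟩

/-- **Web coverage.**  If `G'` is obtained from `G` by attaching a web `W r`
(`r ≥ 3`) along a closed walk `v 0, v 1, …, v (r-1), v 0` of `G`, then every
inner vertex of the attached web is at distance at most `r` in `G'` from some
vertex `v i` of `G`. -/
theorem webAttach_coverage {V : Type*} (G : SimpleGraph V) (r : ℕ) (hr : 3 ≤ r)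
    (v : ZMod r → V) (hwalk : ∀ i : ZMod r, G.Adj (v i) (v (i + 1))) :
    ∀ x : WebInner r, ∃ i : ZMod r,
      (webAttach G r v).edist (Sum.inl (v i)) (Sum.inr x) ≤ (r : ℕ∞) := by
  rintro (_ | ⟨i, n, hn⟩)
  · obtain ⟨p, hp⟩ := webAttach_exists_walk_length G r v 0 (r - 2) (by omega)
    have h : (webAttach G r v).Adj (Sum.inr (some (0, ⟨r - 2, by omega⟩))) (Sum.inr none) := by
      simp [webAttach]
    refine ⟨0, (SimpleGraph.edist_le (p.concat h)).trans ?_⟩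
    rw [SimpleGraph.Walk.length_concat, hp]
    exact_mod_cast (by omega : r - 2 + 1 + 1 ≤ r)
  · obtain ⟨p, hp⟩ := webAttach_exists_walk_length G r v i n hn
    refine ⟨i, (SimpleGraph.edist_le p).trans ?_⟩
    rw [hp]
    exact_mod_cast (by omega : n + 1 ≤ r)
end

section
/- Lower bound on boundary-to-boundary distances in the web: Let r ≥ 3 be an integer and consider the web gadget W_r(v_1,…,v_r). For all distinct i, j ∈ ℤ/rℤ, the distance in W_r between v_i and v_j is strictly greater than the cyclic distance between i and j, i.e., dist_{W_r}(v_i, v_j) ≥ min{(i−j) mod r, (j−i) mod r} + 1. -/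
/-!
Lower bound on boundary-to-boundary distances in the web gadget
(key claim in the proof of Lemma 11(i)).

The web gadget `W r` has vertices `x^i_j` for `i ∈ ℤ/rℤ`, `0 ≤ j ≤ r-1`,
plus an apex `u` (with the convention `x^i_r = u`); the boundary vertices are
`v i = x^i_0`.  Here a vertex `x^i_j` with `0 ≤ j ≤ r-1` is encoded as
`Sum.inl (i, j)` and the apex `u` as `Sum.inr ()`.
-/

/-- The web gadget `W r`.  Its edges are: the path edges `{x^i_j, x^i_{j+1}}`
for `0 ≤ j ≤ r-1` (with `x^i_r = u`); the cycle edges `{x^i_j, x^{i+1}_j}`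
for `1 ≤ j ≤ r-1`; and the diagonal edges `{x^{i-1}_{j-1}, x^i_j}` for
`1 ≤ j ≤ r-1`. -/
def webGraph (r : ℕ) : SimpleGraph ((ZMod r × Fin r) ⊕ Unit) :=
  SimpleGraph.fromRel fun a b =>
    match a, b with
    | Sum.inl (i, j), Sum.inl (i', j') =>
        (i' = i ∧ j'.val = j.val + 1) ∨ (1 ≤ j.val ∧ i' = i + 1 ∧ j' = j) ∨
          (i' = i + 1 ∧ j'.val = j.val + 1)
    | Sum.inl (_, j), Sum.inr _ => j.val = r - 1
    | _, _ => False

/-- A constraint met by every vertex that ends a walk of length `n` starting at the boundary vertex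
`x^i_0`: unless `n ≥ r`, the walk avoids the apex, and the total angular displacement `d ∈ ℤ` along
the walk is bounded in terms of `n` and the depth reached. -/
def WebReach (r : ℕ) (i : ZMod r) (n : ℕ) : (ZMod r × Fin r) ⊕ Unit → Prop
  | Sum.inl (k, m) => r ≤ n ∨ ∃ d : ℤ, (d : ZMod r) = k - i ∧ m.val ≤ n ∧ d ≤ n ∧ m.val ≤ d + n ∧
      (m.val = 0 → n = 0 ∨ (d + 1 ≤ n ∧ 1 ≤ d + n))
  | Sum.inr _ => r ≤ n

theorem WebReach.of_adj {r : ℕ} {i : ZMod r} {n : ℕ} {a b : (ZMod r × Fin r) ⊕ Unit}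
    (h : WebReach r i n a) (hab : (webGraph r).Adj a b) : WebReach r i (n + 1) b := by
  rw [webGraph, SimpleGraph.fromRel_adj] at hab
  obtain ⟨-, hab⟩ := hab
  rcases a with ⟨k, m⟩ | _ <;> rcases b with ⟨k', m'⟩ | _ <;>
    simp only [WebReach, or_false, false_or, or_self] at h hab ⊢
  · rcases h with h | ⟨d, hd, h₁, h₂, h₃, h₄⟩
    · left; omega
    right
    rcases hab with (⟨rfl, hm⟩ | ⟨hm, rfl, rfl⟩ | ⟨rfl, hm⟩) |
      (⟨rfl, hm⟩ | ⟨hm, rfl, rfl⟩ | ⟨rfl, hm⟩)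
    · exact ⟨d, hd, by omega⟩
    · exact ⟨d + 1, by push_cast; rw [hd]; ring, by omega⟩
    · exact ⟨d + 1, by push_cast; rw [hd]; ring, by omega⟩
    · exact ⟨d, hd, by omega⟩
    · exact ⟨d - 1, by push_cast; rw [hd]; ring, by omega⟩
    · exact ⟨d - 1, by push_cast; rw [hd]; ring, by omega⟩
  · rcases h with h | ⟨d, hd, h₁, -⟩ <;> omega
  · left; omega

theorem WebReach.of_walk {r : ℕ} {i : ZMod r} {a b : (ZMod r × Fin r) ⊕ Unit}
    (p : (webGraph r).Walk a b) {n : ℕ} (h : WebReach r i n a) :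
    WebReach r i (n + p.length) b := by
  induction p generalizing n with
  | nil => exact h
  | cons hadj p ih =>
    rw [SimpleGraph.Walk.length_cons, add_comm p.length, ← add_assoc]
    exact ih (h.of_adj hadj)

theorem ZMod.min_val_neg_val_le_natAbs {r : ℕ} (d : ℤ) :
    min (-(d : ZMod r)).val (d : ZMod r).val ≤ d.natAbs := by
  obtain ⟨n, rfl | rfl⟩ := d.eq_nat_or_neg
  · exact (min_le_right _ _).trans (by simpa [ZMod.val_natCast] using Nat.mod_le n r)
  · exact (min_le_left _ _).trans (by simpa [ZMod.val_natCast] using Nat.mod_le n r)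

/-- **Lower bound on boundary-to-boundary distances in the web.**  For `r ≥ 3`
and distinct `i, j ∈ ℤ/rℤ`, the distance in `W r` between the boundary
vertices `v i = x^i_0` and `v j = x^j_0` is strictly greater than the cyclic
distance `min ((i-j) mod r) ((j-i) mod r)` between `i` and `j`. -/
theorem webGraph_boundary_edist_lb (r : ℕ) (hr : 3 ≤ r) (i j : ZMod r) (hij : i ≠ j) :
    ((min (i - j).val (j - i).val + 1 : ℕ) : ℕ∞) ≤
      (webGraph r).edist (Sum.inl (i, ⟨0, by omega⟩)) (Sum.inl (j, ⟨0, by omega⟩)) := by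
  have : NeZero r := ⟨by omega⟩
  refine le_iInf fun p => ?_
  have hstart : WebReach r i 0 (Sum.inl (i, ⟨0, by omega⟩)) := Or.inr ⟨0, by simp⟩
  have hend := WebReach.of_walk p hstart
  rw [zero_add] at hend
  refine Nat.cast_le.mpr ?_
  have hval := ZMod.val_lt (i - j)
  rcases hend with h | ⟨d, hd, -, h₁, h₂, h₃⟩
  · omega
  have hmin := ZMod.min_val_neg_val_le_natAbs (r := r) d
  rw [hd, neg_sub] at hmin
  rcases h₃ rfl with h | h
  · obtain rfl : d = 0 := by simp only [h] at h₁ h₂; omega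
    exact absurd (sub_eq_zero.mp (by simpa using hd.symm)).symm hij
  · omega
end

section
/- Mast attachment preserves distances: Let h ≥ 1 be an integer, let G be a simple graph containing three pairwise adjacent vertices u_1, u_2, u_3, and let G' be the graph obtained from G by attaching a mast of height h at (u_1, u_2, u_3). Then for all vertices u, v ∈ V(G), the extended distance satisfies edist_{G'}(u, v) = edist_G(u, v); moreover, every path in G' between two vertices of V(G) whose length equals their distance in G' contains no inner vertex of the attached mast. -/
/-!
The mast gadget `M h` has vertices `x^i_j` for `i ∈ {1,2,3}`, `0 ≤ j ≤ h`,
where `x^i_0 = u i` and the pole is `v 1 = x^1_h`.  The inner vertices (all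
vertices except `u 1, u 2, u 3`) are encoded as `Fin 3 × Fin h`: the pair
`(i, t)` stands for `x^{i+1}_{t+1}`.
-/

/-- Inner vertices of the mast gadget `M h`. -/
abbrev MastInner (h : ℕ) := Fin 3 × Fin h

/-- The graph obtained from `G` by attaching a mast `M h` at the three
pairwise adjacent vertices `u 0, u 1, u 2`.  Its edges are: the edges of `G`;
the attachment edges `{u i, x^i_1}` together with `{u 1, x^2_1}`,
`{u 1, x^3_1}`, `{u 2, x^3_1}` (i.e. `u i'` is joined to `x^i_1` whenever
`i' ≤ i`); the path edges `{x^i_j, x^i_{j+1}}`; the triangle edges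
`{x^i_j, x^{i'}_j}` for `1 ≤ j ≤ h` and `i ≠ i'`; and the diagonal edges
`{x^{i'}_{j-1}, x^i_j}` for `i' < i` and `2 ≤ j ≤ h` (the case `j = 1`
being an attachment edge). -/
def mastAttach {V : Type*} (G : SimpleGraph V) (h : ℕ) (u : Fin 3 → V) :
    SimpleGraph (V ⊕ MastInner h) :=
  SimpleGraph.fromRel fun a b =>
    match a, b with
    | Sum.inl a, Sum.inl b => G.Adj a b
    | Sum.inl a, Sum.inr (i, t) => t.val = 0 ∧ ∃ i' : Fin 3, i' ≤ i ∧ a = u i'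
    | Sum.inr (i, t), Sum.inr (i', t') =>
        (i = i' ∧ t'.val = t.val + 1) ∨ (t = t' ∧ i ≠ i') ∨
          (i < i' ∧ t'.val = t.val + 1)
    | _, _ => False

theorem mastAttach_adj_inl_inl {V : Type*} {G : SimpleGraph V} {h : ℕ} {u : Fin 3 → V} {a b : V} :
    (mastAttach G h u).Adj (Sum.inl a) (Sum.inl b) ↔ G.Adj a b := by
  simp only [mastAttach, SimpleGraph.fromRel_adj, ne_eq, Sum.inl.injEq]
  exact ⟨fun hab => hab.2.elim id SimpleGraph.Adj.symm, fun hab => ⟨hab.ne, Or.inl hab⟩⟩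

/-- Every neighbour in `V` of an inner vertex of the mast is one of the `u i`. -/
theorem exists_eq_of_mastAttach_adj_inl_inr {V : Type*} {G : SimpleGraph V} {h : ℕ}
    {u : Fin 3 → V} {a : V} {m : MastInner h}
    (ham : (mastAttach G h u).Adj (Sum.inl a) (Sum.inr m)) : ∃ i, a = u i := by
  obtain ⟨-, ⟨-, i, -, hi⟩ | hfalse⟩ := (SimpleGraph.fromRel_adj _ _ _).1 ham
  · exact ⟨i, hi⟩
  · exact hfalse.elim

/-- The inclusion of `G` into the graph with an attached mast. -/
def mastAttachInl {V : Type*} (G : SimpleGraph V) (h : ℕ) (u : Fin 3 → V) :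
    G →g mastAttach G h u where
  toFun := Sum.inl
  map_rel' := mastAttach_adj_inl_inl.2

theorem mastAttach_edist_le {V : Type*} (G : SimpleGraph V) (h : ℕ) (u : Fin 3 → V) (a b : V) :
    (mastAttach G h u).edist (Sum.inl a) (Sum.inl b) ≤ G.edist a b := by
  refine le_iInf fun p => ?_
  have hp := (p.map (mastAttachInl G h u)).edist_le
  rwa [SimpleGraph.Walk.length_map] at hp

/-- A walk ending in `V` is at least as long as the distance in `G` from its start to its end, with
one extra step whenever it meets the mast. A start in the mast is replaced by a suitable `u i`. -/
theorem edist_le_length_of_mastAttach_walk {V : Type*} {G : SimpleGraph V} {h : ℕ}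
    {u : Fin 3 → V} (hadj : ∀ i j : Fin 3, i ≠ j → G.Adj (u i) (u j))
    {x y : V ⊕ MastInner h} (p : (mastAttach G h u).Walk x y) {b : V} (hy : y = Sum.inl b) :
    (∀ a, x = Sum.inl a → G.edist a b ≤ p.length ∧
      ∀ m, Sum.inr m ∈ p.support → G.edist a b + 1 ≤ p.length) ∧
    ∀ m, x = Sum.inr m → ∃ i, G.edist (u i) b + 1 ≤ p.length := by
  induction p with
  | nil => subst hy; simp
  | @cons x z y hxz p ih =>
    obtain ⟨ih_inl, ih_inr⟩ := ih hy
    simp only [SimpleGraph.Walk.length_cons, Nat.cast_add, Nat.cast_one]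
    refine ⟨?_, ?_⟩
    · rintro a rfl
      rcases z with c | m
      · obtain ⟨hle, hlt⟩ := ih_inl c rfl
        have hac : G.edist a b ≤ G.edist c b + 1 := by
          rw [add_comm, ← SimpleGraph.edist_eq_one_iff_adj.2 (mastAttach_adj_inl_inl.1 hxz)]
          exact SimpleGraph.edist_triangle
        refine ⟨hac.trans (by gcongr), fun m hm => ?_⟩
        have hm' : Sum.inr m ∈ p.support := by simpa using hm
        have := hac.trans (hlt m hm')
        gcongr
      · obtain ⟨j, rfl⟩ := exists_eq_of_mastAttach_adj_inl_inr hxz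
        obtain ⟨i, hi⟩ := ih_inr m rfl
        have hji : G.edist (u j) b ≤ G.edist (u i) b + 1 := by
          by_cases hne : j = i
          · subst hne; exact le_self_add
          · rw [add_comm, ← SimpleGraph.edist_eq_one_iff_adj.2 (hadj j i hne)]
            exact SimpleGraph.edist_triangle
        have := hji.trans hi
        exact ⟨this.trans le_self_add, fun _ _ => by gcongr⟩
    · rintro m rfl
      rcases z with c | m'
      · obtain ⟨i, rfl⟩ := exists_eq_of_mastAttach_adj_inl_inr hxz.symm
        have := (ih_inl _ rfl).1
        exact ⟨i, by gcongr⟩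
      · obtain ⟨i, hi⟩ := ih_inr m' rfl
        exact ⟨i, hi.trans le_self_add⟩

/-- **Mast attachment preserves distances.**  If `G'` is obtained from `G` by
attaching a mast of height `h ≥ 1` at three pairwise adjacent vertices
`u 0, u 1, u 2` of `G`, then the extended distance between any two vertices of
`G` is the same in `G'` as in `G`; moreover any shortest path of `G'` between
two vertices of `G` avoids all inner vertices of the attached mast. -/
theorem mastAttach_preserves_edist {V : Type*} (G : SimpleGraph V) (h : ℕ) (hh : 1 ≤ h)
    (u : Fin 3 → V) (hadj : ∀ i j : Fin 3, i ≠ j → G.Adj (u i) (u j)) :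
    (∀ a b : V,
      (mastAttach G h u).edist (Sum.inl a) (Sum.inl b) = G.edist a b) ∧
    (∀ a b : V, ∀ p : (mastAttach G h u).Walk (Sum.inl a) (Sum.inl b), p.IsPath →
      (p.length : ℕ∞) = (mastAttach G h u).edist (Sum.inl a) (Sum.inl b) →
      ∀ x ∈ p.support, ∃ c : V, x = Sum.inl c) := by
  refine ⟨fun a b => (mastAttach_edist_le G h u a b).antisymm <| le_iInf fun p =>
    ((edist_le_length_of_mastAttach_walk hadj p rfl).1 a rfl).1, fun a b p _ hp x hx => ?_⟩
  rcases x with c | m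
  · exact ⟨c, rfl⟩
  · have hlt := ((edist_le_length_of_mastAttach_walk hadj p rfl).1 a rfl).2 m hx
    have hle := hp.trans_le (mastAttach_edist_le G h u a b)
    have : ((p.length + 1 : ℕ) : ℕ∞) ≤ p.length := by
      push_cast
      exact (add_le_add_left hle 1).trans hlt
    exact absurd (Nat.cast_le.1 this) (by lia)
end

section
/- Mast radius from the root: Let h ≥ 1 be an integer, let G be a simple graph containing three pairwise adjacent vertices u_1, u_2, u_3, and let G' be the graph obtained from G by attaching a mast of height h at (u_1, u_2, u_3). Then every vertex of the attached mast (i.e., every inner vertex of the mast, as well as u_1, u_2 and u_3) is at distance at most h in G' from u_1. -/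
/-- Climbing a single path of the mast reaches level `t + 1` from the root in `t + 1` steps. -/
theorem mastAttach_edist_inner_le {V : Type*} (G : SimpleGraph V) (h : ℕ) (u : Fin 3 → V)
    (i : Fin 3) (t : ℕ) (ht : t < h) :
    (mastAttach G h u).edist (Sum.inl (u 0)) (Sum.inr (i, ⟨t, ht⟩)) ≤ ((t + 1 : ℕ) : ℕ∞) := by
  induction t with
  | zero =>
    have hA : (mastAttach G h u).Adj (Sum.inl (u 0)) (Sum.inr (i, ⟨0, ht⟩)) := by
      rw [mastAttach, SimpleGraph.fromRel_adj]
      exact ⟨Sum.inl_ne_inr, Or.inl ⟨rfl, 0, Fin.zero_le i, rfl⟩⟩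
    simpa using (SimpleGraph.edist_eq_one_iff_adj.mpr hA).le
  | succ t ih =>
    have hA : (mastAttach G h u).Adj (Sum.inr (i, ⟨t, by lia⟩)) (Sum.inr (i, ⟨t + 1, ht⟩)) := by
      rw [mastAttach, SimpleGraph.fromRel_adj]
      exact ⟨by simp, Or.inl (Or.inl ⟨rfl, rfl⟩)⟩
    rw [Nat.cast_add_one (t + 1)]
    exact SimpleGraph.edist_triangle.trans
      (add_le_add (ih (by lia)) (SimpleGraph.edist_eq_one_iff_adj.mpr hA).le)

/-- **Mast radius from the root.**  If `G'` is obtained from `G` by attaching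
a mast of height `h ≥ 1` at three pairwise adjacent vertices `u 0, u 1, u 2`
of `G`, then every vertex of the attached mast (every inner vertex as well as
`u 0`, `u 1`, `u 2`) is at distance at most `h` in `G'` from the root `u 0`. -/
theorem mastAttach_radius {V : Type*} (G : SimpleGraph V) (h : ℕ) (hh : 1 ≤ h)
    (u : Fin 3 → V) (hadj : ∀ i j : Fin 3, i ≠ j → G.Adj (u i) (u j)) :
    (∀ i : Fin 3,
      (mastAttach G h u).edist (Sum.inl (u 0)) (Sum.inl (u i)) ≤ (h : ℕ∞)) ∧
    (∀ x : MastInner h,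
      (mastAttach G h u).edist (Sum.inl (u 0)) (Sum.inr x) ≤ (h : ℕ∞)) := by
  refine ⟨fun i => ?_, fun ⟨i, t, ht⟩ => ?_⟩
  · rcases eq_or_ne i 0 with rfl | hi
    · simp
    · have hG := hadj 0 i hi.symm
      have hA : (mastAttach G h u).Adj (Sum.inl (u 0)) (Sum.inl (u i)) := by
        rw [mastAttach, SimpleGraph.fromRel_adj]
        exact ⟨fun e => hG.ne (Sum.inl_injective e), Or.inl hG⟩
      rw [SimpleGraph.edist_eq_one_iff_adj.mpr hA]
      exact_mod_cast hh
  · exact (mastAttach_edist_inner_le G h u i t ht).trans (by exact_mod_cast ht)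
end

section
/- Distances among inner mast vertices: Let h ≥ 1 be an integer, let G be a simple graph containing three pairwise adjacent vertices u_1, u_2, u_3, and let G' be the graph obtained from G by attaching a mast of height h at (u_1, u_2, u_3). Then for any two inner vertices x, y of the attached mast, dist_{G'}(x, y) ≤ h. -/
/-- Climbing `d` levels along one of the three paths of the mast takes at most `d` steps. -/
theorem mastAttach_edist_path_le {V : Type*} (G : SimpleGraph V) (h : ℕ) (u : Fin 3 → V)
    (i : Fin 3) (s : Fin h) (d : ℕ) :
    ∀ t : Fin h, t.val = s.val + d →
      (mastAttach G h u).edist (Sum.inr (i, s)) (Sum.inr (i, t)) ≤ (d : ℕ∞) := by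
  induction d with
  | zero =>
    intro t ht
    obtain rfl : t = s := Fin.ext ht
    simp
  | succ d ih =>
    intro t ht
    have hlt : s.val + d < h := by have := t.isLt; omega
    have hadj : (mastAttach G h u).Adj (Sum.inr (i, ⟨s.val + d, hlt⟩)) (Sum.inr (i, t)) := by
      rw [mastAttach, SimpleGraph.fromRel_adj]
      refine ⟨?_, Or.inl (Or.inl ⟨rfl, ht⟩)⟩
      intro he
      simp only [Sum.inr.injEq, Prod.mk.injEq, Fin.ext_iff] at he
      omega
    calc _ ≤ _ := SimpleGraph.edist_triangle (v := Sum.inr (i, ⟨s.val + d, hlt⟩))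
      _ ≤ (d : ℕ∞) + 1 := add_le_add (ih _ rfl) (SimpleGraph.edist_eq_one_iff_adj.2 hadj).le
      _ = ((d + 1 : ℕ) : ℕ∞) := by push_cast; rfl

/-- Two vertices on the same level of the mast are at distance at most one. -/
theorem mastAttach_edist_level_le_one {V : Type*} (G : SimpleGraph V) (h : ℕ) (u : Fin 3 → V)
    (i j : Fin 3) (t : Fin h) :
    (mastAttach G h u).edist (Sum.inr (i, t)) (Sum.inr (j, t)) ≤ 1 := by
  by_cases hij : i = j
  · simp [hij]
  · refine (SimpleGraph.edist_eq_one_iff_adj.2 ?_).le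
    rw [mastAttach, SimpleGraph.fromRel_adj]
    exact ⟨by simp [hij], Or.inl (Or.inr (Or.inl ⟨rfl, hij⟩))⟩

theorem mastAttach_edist_le_of_le {V : Type*} (G : SimpleGraph V) (h : ℕ) (u : Fin 3 → V)
    (i j : Fin 3) {s t : Fin h} (hst : s ≤ t) :
    (mastAttach G h u).edist (Sum.inr (i, s)) (Sum.inr (j, t)) ≤ (h : ℕ∞) := by
  have hst' : s.val ≤ t.val := hst
  calc _ ≤ _ := SimpleGraph.edist_triangle (v := Sum.inr (i, t))
    _ ≤ ((t.val - s.val : ℕ) : ℕ∞) + 1 :=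
      add_le_add (mastAttach_edist_path_le G h u i s _ t (by omega))
        (mastAttach_edist_level_le_one G h u i j t)
    _ ≤ (h : ℕ∞) := by
      have := t.isLt
      exact_mod_cast (by omega : t.val - s.val + 1 ≤ h)

/-- **Distances among inner mast vertices.**  If `G'` is obtained from `G` by
attaching a mast of height `h ≥ 1` at three pairwise adjacent vertices
`u 0, u 1, u 2` of `G`, then any two inner vertices of the attached mast are
at distance at most `h` in `G'`. -/
theorem mastAttach_inner_edist {V : Type*} (G : SimpleGraph V) (h : ℕ) (hh : 1 ≤ h)
    (u : Fin 3 → V) (hadj : ∀ i j : Fin 3, i ≠ j → G.Adj (u i) (u j)) :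
    ∀ x y : MastInner h,
      (mastAttach G h u).edist (Sum.inr x) (Sum.inr y) ≤ (h : ℕ∞) := by
  rintro ⟨i, s⟩ ⟨j, t⟩
  rcases le_total s t with hst | hts
  · exact mastAttach_edist_le_of_le G h u i j hst
  · rw [SimpleGraph.edist_comm]
    exact mastAttach_edist_le_of_le G h u j i hts
end

section
/- Variable duplication with cyclic implication clauses preserves satisfiability: Let V be a type of variables, let φ be a CNF formula over V given as a finite list of clauses (each clause a finite list of literals, where a literal is a pair (y, b) with y ∈ V and b ∈ Bool, satisfied by an assignment τ when τ(y) = b). Fix a variable x ∈ V and an integer m ≥ 1, and let φ' be a CNF formula over the variable type V ⊕ ℤ/mℤ consisting of: (a) for each clause C of φ, a clause C' obtained from C by replacing every literal of the form (x, b) by (inr k, b) for some (arbitrary, possibly occurrence-dependent) k ∈ ℤ/mℤ, and replacing every literal (y, b) with y ≠ x by (inl y, b); and (b) for each k ∈ ℤ/mℤ, the clause consisting of the two literals (inr (k−1), false) and (inr k, true). Then φ is satisfiable if and only if φ' is satisfiable. -/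
/-!
Variable duplication with cyclic implication clauses preserves satisfiability
(the single-variable step of the transformation in the proof of Lemma 10).

A CNF formula over a variable type `V` is a list of clauses; a clause is a
list of literals; a literal is a pair `(y, b) : V × Bool`, satisfied by an
assignment `τ` when `τ y = b`.
-/

/-- An assignment `τ` satisfies a CNF formula `φ` if every clause of `φ`
contains a literal `(y, b)` with `τ y = b`. -/
def SatCNF {V : Type*} (τ : V → Bool) (φ : List (List (V × Bool))) : Prop :=
  ∀ C ∈ φ, ∃ l ∈ C, τ l.1 = l.2

/-- A CNF formula is satisfiable if some assignment satisfies it. -/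
def CNFSatisfiable {V : Type*} (φ : List (List (V × Bool))) : Prop :=
  ∃ τ : V → Bool, SatCNF τ φ

/-- `LitRepl x l l'` holds when the literal `l'` (over `V ⊕ ℤ/mℤ`) is
obtained from the literal `l` (over `V`) by replacing the variable `x` by one
of its (arbitrarily chosen) copies `Sum.inr k`, and keeping any variable
`y ≠ x` as `Sum.inl y`. -/
def LitRepl {V : Type*} (x : V) (m : ℕ) (l : V × Bool) (l' : (V ⊕ ZMod m) × Bool) : Prop :=
  (l.1 = x ∧ ∃ k : ZMod m, l' = (Sum.inr k, l.2)) ∨ (l.1 ≠ x ∧ l' = (Sum.inl l.1, l.2))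

/-- The cyclic implication clauses `¬x_{k-1} ∨ x_k`, one for each
`k ∈ ℤ/mℤ`, on the copies `Sum.inr k` of the duplicated variable. -/
def cycClauses (V : Type*) (m : ℕ) : List (List ((V ⊕ ZMod m) × Bool)) :=
  (List.finRange m).map fun t =>
    [(Sum.inr ((((t : ℕ) : ZMod m)) - 1), false), (Sum.inr (((t : ℕ) : ZMod m)), true)]

theorem List.Forall₂.exists_mem_iff {α β : Type*} {R : α → β → Prop} {p : α → Prop} {q : β → Prop}
    (hpq : ∀ a b, R a b → (p a ↔ q b)) {l : List α} {l' : List β} (h : List.Forall₂ R l l') :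
    (∃ a ∈ l, p a) ↔ ∃ b ∈ l', q b := by
  induction h with
  | nil => simp
  | cons hab _ ih => simp only [List.exists_mem_cons_iff, hpq _ _ hab, ih]

theorem List.Forall₂.forall_mem_iff {α β : Type*} {R : α → β → Prop} {p : α → Prop} {q : β → Prop}
    (hpq : ∀ a b, R a b → (p a ↔ q b)) {l : List α} {l' : List β} (h : List.Forall₂ R l l') :
    (∀ a ∈ l, p a) ↔ ∀ b ∈ l', q b := by
  induction h with
  | nil => simp
  | cons hab _ ih => simp only [List.forall_mem_cons, hpq _ _ hab, ih]

theorem satCNF_append {V : Type*} (τ : V → Bool) (φ χ : List (List (V × Bool))) :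
    SatCNF τ (φ ++ χ) ↔ SatCNF τ φ ∧ SatCNF τ χ :=
  List.forall_mem_append

/-- If `τ'` gives every copy of `x` the value `τ x` and agrees with `τ` on the variables `y ≠ x`,
then replacing literals does not change the truth value of a formula. -/
theorem satCNF_iff_of_litRepl {V : Type*} {x : V} {m : ℕ} {φ : List (List (V × Bool))}
    {ψ : List (List ((V ⊕ ZMod m) × Bool))}
    (hrepl : List.Forall₂ (List.Forall₂ (LitRepl x m)) φ ψ)
    {τ : V → Bool} {τ' : V ⊕ ZMod m → Bool} (hinl : ∀ y, y ≠ x → τ' (Sum.inl y) = τ y)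
    (hinr : ∀ k, τ' (Sum.inr k) = τ x) :
    SatCNF τ φ ↔ SatCNF τ' ψ := by
  refine List.Forall₂.forall_mem_iff (fun C C' hC => List.Forall₂.exists_mem_iff ?_ hC) hrepl
  rintro ⟨y, b⟩ l' (⟨rfl, k, rfl⟩ | ⟨hy, rfl⟩)
  · simp [hinr]
  · simp [hinl y hy]

/-- The cyclic implication clauses say that truth propagates from each copy to the next. -/
theorem satCNF_cycClauses_iff {V : Type*} {m : ℕ} [NeZero m] (τ : V ⊕ ZMod m → Bool) :
    SatCNF τ (cycClauses V m) ↔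
      ∀ k : ZMod m, τ (Sum.inr (k - 1)) = true → τ (Sum.inr k) = true := by
  have hclause (k : ZMod m) :
      (∃ l ∈ [((Sum.inr (k - 1) : V ⊕ ZMod m), false), (Sum.inr k, true)], τ l.1 = l.2) ↔
        (τ (Sum.inr (k - 1)) = true → τ (Sum.inr k) = true) := by
    cases h : τ (Sum.inr (k - 1)) <;> simp [h]
  simp only [SatCNF, cycClauses, List.forall_mem_map, hclause]
  refine ⟨fun h k => ?_, fun h t _ => h _⟩
  simpa using h k.val (by simpa using ⟨⟨k.val, k.val_lt⟩, rfl⟩)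

/-- The cyclic implication clauses force all copies to take the same value. -/
theorem SatCNF.inr_eq_inr_zero {V : Type*} {m : ℕ} [NeZero m] {τ : V ⊕ ZMod m → Bool}
    (h : SatCNF τ (cycClauses V m)) (k : ZMod m) : τ (Sum.inr k) = τ (Sum.inr 0) := by
  rw [satCNF_cycClauses_iff] at h
  have hadd (k : ZMod m) (n : ℕ) (hk : τ (Sum.inr k) = true) :
      τ (Sum.inr (k + n)) = true := by
    induction n with
    | zero => simpa using hk
    | succ n ih => exact h _ (by simpa [← add_assoc] using ih)
  refine Bool.eq_iff_iff.2 ⟨fun hk => ?_, fun h0 => ?_⟩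
  · simpa using hadd k (-k).val hk
  · simpa using hadd 0 k.val h0

/-- **Variable duplication with cyclic implication clauses preserves
satisfiability.**  Let `ψ` be obtained from `φ` by replacing, clause by clause
and literal by literal, every occurrence of the variable `x` by some
(occurrence-dependent) copy `Sum.inr k` with `k ∈ ℤ/mℤ`, `m ≥ 1`.  Then `φ`
is satisfiable iff `ψ` together with the cyclic implication clauses
`¬x_{k-1} ∨ x_k` (for `k ∈ ℤ/mℤ`) is satisfiable. -/
theorem duplication_preserves_satisfiability {V : Type*} (φ : List (List (V × Bool)))
    (x : V) (m : ℕ) (hm : 1 ≤ m) (ψ : List (List ((V ⊕ ZMod m) × Bool)))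
    (hrepl : List.Forall₂ (List.Forall₂ (LitRepl x m)) φ ψ) :
    CNFSatisfiable φ ↔ CNFSatisfiable (ψ ++ cycClauses V m) := by
  have : NeZero m := ⟨by omega⟩
  constructor
  · rintro ⟨τ, hτ⟩
    refine ⟨Sum.elim τ fun _ => τ x, (satCNF_append _ _ _).2 ⟨?_, ?_⟩⟩
    · exact (satCNF_iff_of_litRepl hrepl (fun _ _ => rfl) fun _ => rfl).1 hτ
    · exact (satCNF_cycClauses_iff _).2 fun _ h => h
  · rintro ⟨τ', hτ'⟩
    obtain ⟨hψ, hcyc⟩ := (satCNF_append _ _ _).1 hτ'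
    classical
    refine ⟨Function.update (fun y => τ' (Sum.inl y)) x (τ' (Sum.inr 0)),
      (satCNF_iff_of_litRepl hrepl (fun y hy => ?_) fun k => ?_).2 hψ⟩
    · rw [Function.update_of_ne hy]
    · rw [Function.update_self, hcyc.inr_eq_inr_zero]
end

section
/- Distance decomposition across a separator: Let V be a finite vertex set, let G₁ and G₂ be simple graphs on V, and let G = G₁ ⊔ G₂ be the simple graph on V whose edge set is the union of the edge sets of G₁ and G₂. Let S ⊆ V be a set such that every vertex that is an endpoint of some edge of G₁ and also an endpoint of some edge of G₂ belongs to S. Then for all u, v ∈ V, the extended distance edist_G(u, v) equals the minimum, over all integers k ≥ 0, all sequences of pairwise distinct vertices s_1, …, s_k ∈ S, and all side choices ε_0, …, ε_k ∈ {1, 2}, of the sum Σ_{t=0}^{k} edist_{G_{ε_t}}(w_t, w_{t+1}), where w_0 = u, w_{k+1} = v, and w_t = s_t for 1 ≤ t ≤ k (all distances taken in ℕ∞, with the convention that the minimum of an empty or all-infinite collection is ∞). -/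
namespace SimpleGraph

variable {V : Type*}

/-- Iterated triangle inequality, with each step measured in a subgraph. -/
theorem edist_le_sum_of_le (G : SimpleGraph V) :
    ∀ {n : ℕ} (H : Fin n → SimpleGraph V) (_ : ∀ t, H t ≤ G) (w : Fin (n + 1) → V),
      G.edist (w 0) (w (Fin.last n)) ≤ ∑ t : Fin n, (H t).edist (w t.castSucc) (w t.succ)
  | 0, _, _, _ => by simp
  | n + 1, H, hH, w => by
    rw [Fin.sum_univ_castSucc]
    exact G.edist_triangle.trans <| add_le_add
      (edist_le_sum_of_le G (fun t ↦ H t.castSucc) (fun t ↦ hH _) (fun t ↦ w t.castSucc))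
      (edist_anti (hH _))

theorem exists_adj_of_edist_ne_top {G : SimpleGraph V} {u v : V} (h : G.edist u v ≠ ⊤)
    (hne : u ≠ v) : ∃ y, G.Adj u y := by
  obtain ⟨p⟩ := reachable_of_edist_ne_top h
  cases p with
  | nil => exact absurd rfl hne
  | cons hadj _ => exact ⟨_, hadj⟩

/-- Outside a separator, an edge of one side can be prepended to a step measured in either side. -/
theorem edist_le_one_add_of_notMem_separator {G : Bool → SimpleGraph V} {S : Set V}
    (hS : ∀ x, (∃ y, (G true).Adj x y) → (∃ y, (G false).Adj x y) → x ∈ S)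
    {b c : Bool} {u w x : V} (hadj : (G b).Adj u w) (hw : w ∉ S) :
    (G b).edist u x ≤ 1 + (G c).edist w x := by
  have h1 : (G b).edist u w = 1 := edist_eq_one_iff_adj.mpr hadj
  by_cases hwx : w = x
  · subst hwx
    simp [h1]
  by_cases htop : (G c).edist w x = ⊤
  · simp [htop]
  have hc := exists_adj_of_edist_ne_top htop hwx
  have hb : ∃ y, (G b).Adj w y := ⟨u, hadj.symm⟩
  have hbc : b = c := by
    cases b <;> cases c <;> first | rfl | exact absurd (hS w ‹_› ‹_›) hw
  subst hbc
  exact h1 ▸ (G b).edist_triangle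

/-- A path in a union of two graphs is no shorter than some chain through the separator. -/
theorem Walk.IsPath.exists_separator_chain {H : SimpleGraph V} {G : Bool → SimpleGraph V}
    {S : Set V} (hH : ∀ x y, H.Adj x y → ∃ b, (G b).Adj x y)
    (hS : ∀ x, (∃ y, (G true).Adj x y) → (∃ y, (G false).Adj x y) → x ∈ S)
    {u v : V} {p : H.Walk u v} (hp : p.IsPath) :
    ∃ (k : ℕ) (s : Fin k → V), Function.Injective s ∧ (∀ t, s t ∈ S) ∧
      (∀ t, s t ∈ p.support.tail) ∧ ∃ ε : Fin (k + 1) → Bool,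
        ∑ t : Fin (k + 1), (G (ε t)).edist
            ((Fin.cons u (Fin.snoc s v) : Fin (k + 2) → V) t.castSucc)
            ((Fin.cons u (Fin.snoc s v) : Fin (k + 2) → V) t.succ) ≤ p.length := by
  induction p with
  | nil =>
    refine ⟨0, Fin.elim0, fun t ↦ t.elim0, fun t ↦ t.elim0, fun t ↦ t.elim0, fun _ ↦ true, ?_⟩
    simp [Fin.snoc]
  | @cons u w v hadj p ih =>
    obtain ⟨k, s, hinj, hsS, hsp, ε, hle⟩ := ih hp.of_cons
    obtain ⟨b, hb⟩ := hH _ _ hadj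
    have hnodup := hp.of_cons.support_nodup
    rw [← Walk.cons_tail_support, List.nodup_cons] at hnodup
    by_cases hw : w ∈ S
    · refine ⟨k + 1, Fin.cons w s, Fin.cons_injective_iff.mpr ⟨?_, hinj⟩,
        Fin.cases hw hsS, fun t ↦ ?_, Fin.cons b ε, ?_⟩
      · rintro ⟨t, rfl⟩
        exact hnodup.1 (hsp t)
      · cases t using Fin.cases with
        | zero => simp
        | succ t => simpa using List.mem_of_mem_tail (hsp t)
      · rw [Fin.sum_univ_succ, ← Fin.cons_snoc_eq_snoc_cons]
        simp only [Fin.cons_zero, Fin.cons_succ, Fin.castSucc_zero, ← Fin.succ_castSucc,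
          Walk.length_cons, Nat.cast_add, Nat.cast_one, edist_eq_one_iff_adj.mpr hb]
        rw [add_comm (p.length : ℕ∞)]
        exact add_le_add_right hle 1
    · refine ⟨k, s, hinj, hsS, fun t ↦ ?_, Fin.cons b (Fin.tail ε), ?_⟩
      · simpa using List.mem_of_mem_tail (hsp t)
      · rw [Fin.sum_univ_succ] at hle ⊢
        simp only [Fin.cons_zero, Fin.cons_succ, Fin.castSucc_zero, ← Fin.succ_castSucc,
          Walk.length_cons, Nat.cast_add, Nat.cast_one, Fin.tail] at hle ⊢
        rw [add_comm (p.length : ℕ∞)]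
        refine le_trans ?_ (add_le_add_right hle 1)
        rw [← add_assoc]
        exact add_le_add_left (edist_le_one_add_of_notMem_separator hS hb hw) _

end SimpleGraph

/-- **Distance decomposition across a separator.**  Let `G₁` and `G₂` be
simple graphs on a finite vertex set `V`, and let `S` contain every vertex
that is an endpoint of an edge of `G₁` and also an endpoint of an edge of
`G₂`.  Then the extended distance between `u` and `v` in `G₁ ⊔ G₂` is the
infimum, over all `k : ℕ`, all injective sequences `s : Fin k → V` of
vertices of `S`, and all side choices `ε : Fin (k+1) → Bool`, of
`∑ t, edist_{G_{ε t}} (w t) (w (t+1))`, where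
`w = (u, s 0, …, s (k-1), v)`. -/
theorem edist_sup_eq_iInf_separator {V : Type*} [Fintype V]
    (G₁ G₂ : SimpleGraph V) (S : Set V)
    (hS : ∀ x : V, (∃ y, G₁.Adj x y) → (∃ y, G₂.Adj x y) → x ∈ S) (u v : V) :
    (G₁ ⊔ G₂).edist u v =
      ⨅ (k : ℕ) (s : Fin k → V) (_ : Function.Injective s) (_ : ∀ t, s t ∈ S)
        (ε : Fin (k + 1) → Bool),
        ∑ t : Fin (k + 1),
          (if ε t then G₁ else G₂).edist
            ((Fin.cons u (Fin.snoc s v) : Fin (k + 2) → V) t.castSucc)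
            ((Fin.cons u (Fin.snoc s v) : Fin (k + 2) → V) t.succ) := by
  apply le_antisymm
  · refine le_iInf fun k ↦ le_iInf fun s ↦ le_iInf fun _ ↦ le_iInf fun _ ↦ le_iInf fun ε ↦ ?_
    have h := SimpleGraph.edist_le_sum_of_le (G₁ ⊔ G₂) (fun t ↦ if ε t then G₁ else G₂)
      (fun t ↦ by split_ifs <;> simp) (Fin.cons u (Fin.snoc s v) : Fin (k + 2) → V)
    rwa [Fin.cons_zero, ← Fin.succ_last, Fin.cons_succ, Fin.snoc_last] at h
  · by_cases htop : (G₁ ⊔ G₂).edist u v = ⊤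
    · simp [htop]
    obtain ⟨p, hp⟩ := SimpleGraph.exists_walk_of_edist_ne_top htop
    classical
    obtain ⟨k, s, hinj, hsS, -, ε, hle⟩ :=
      p.bypass_isPath.exists_separator_chain (G := fun b ↦ if b then G₁ else G₂) (S := S)
        (fun x y h ↦ (SimpleGraph.sup_adj _ _ _ _).mp h |>.elim
          (fun h ↦ ⟨true, by simpa using h⟩) fun h ↦ ⟨false, by simpa using h⟩)
        (by simpa using hS)
    rw [← hp]
    refine iInf_le_of_le k <| iInf_le_of_le s ?_
    refine iInf_le_of_le hinj <| iInf_le_of_le hsS <| iInf_le_of_le ε <| hle.trans ?_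
    exact_mod_cast p.length_bypass_le_length
end
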